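/- arXiv:1111.2475 — 6 statements merged into one kernel-verified Lean document; each statement's English description precedes it below -/
import Mathlib

section
/- Let F be a field of characteristic different from 2 and 3, and let u₂, u₃, u₄ ∈ F with u₂·u₃ ≠ 0. With x = (u₄² + 2u₂⁵u₄ + 4u₂²u₃³ + u₂¹⁰)/(12u₂⁴u₃²), g₂ = (u₂²⁰ + 4u₂¹⁵u₄ − 16u₂¹²u₃³ + 6u₂¹⁰u₄² − 8u₂⁷u₃³u₄ + 4u₂⁵u₄³ + 16u₂⁴u₃⁶ + 8u₂²u₃³u₄² + u₄⁴)/(12u₂⁸u₃⁴) and g₃ = −(u₂³⁰ + 6u₂²⁵u₄ − 24u₂²²u₃³ + 15u₂²⁰u₄² − 60u₂¹⁷u₃³u₄ + 20u₂¹⁵u₄³ + 120u₂¹⁴u₃⁶ − 36u₂¹²u₃³u₄² + 15u₂¹⁰u₄⁴ − 48u₂⁹u₃⁶u₄ + 12u₂⁷u₃³u₄³ + 64u₂⁶u₃⁹ + 6u₂⁵u₄⁵ + 48u₂⁴u₃⁶u₄² + 12u₂²u₃³u₄⁴ + u₄⁶)/(216u₂¹²u₃⁶), the point (x, −u₂)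 lies on the curve y² = 4x³ − g₂x − g₃; that is, u₂² = 4x³ − g₂·x − g₃ holds identically in u₂, u₃, u₄. (Ward's construction of a point on a short Weierstrass curve from the defining terms of a proper elliptic divisibility sequence.) -/
/-- Ward's `x`-coordinate recovered from the defining terms `u₂, u₃, u₄`. -/
noncomputable def wardX {F : Type*} [Field F] (u₂ u₃ u₄ : F) : F :=
  (u₄ ^ 2 + 2 * u₂ ^ 5 * u₄ + 4 * u₂ ^ 2 * u₃ ^ 3 + u₂ ^ 10) / (12 * u₂ ^ 4 * u₃ ^ 2)

/-- Ward's invariant `g₂` recovered from the defining terms `u₂, u₃, u₄`. -/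
noncomputable def wardG₂ {F : Type*} [Field F] (u₂ u₃ u₄ : F) : F :=
  (u₂ ^ 20 + 4 * u₂ ^ 15 * u₄ - 16 * u₂ ^ 12 * u₃ ^ 3 + 6 * u₂ ^ 10 * u₄ ^ 2
      - 8 * u₂ ^ 7 * u₃ ^ 3 * u₄ + 4 * u₂ ^ 5 * u₄ ^ 3 + 16 * u₂ ^ 4 * u₃ ^ 6
      + 8 * u₂ ^ 2 * u₃ ^ 3 * u₄ ^ 2 + u₄ ^ 4) / (12 * u₂ ^ 8 * u₃ ^ 4)

/-- Ward's invariant `g₃` recovered from the defining terms `u₂, u₃, u₄`. -/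
noncomputable def wardG₃ {F : Type*} [Field F] (u₂ u₃ u₄ : F) : F :=
  -(u₂ ^ 30 + 6 * u₂ ^ 25 * u₄ - 24 * u₂ ^ 22 * u₃ ^ 3 + 15 * u₂ ^ 20 * u₄ ^ 2
      - 60 * u₂ ^ 17 * u₃ ^ 3 * u₄ + 20 * u₂ ^ 15 * u₄ ^ 3 + 120 * u₂ ^ 14 * u₃ ^ 6
      - 36 * u₂ ^ 12 * u₃ ^ 3 * u₄ ^ 2 + 15 * u₂ ^ 10 * u₄ ^ 4 - 48 * u₂ ^ 9 * u₃ ^ 6 * u₄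
      + 12 * u₂ ^ 7 * u₃ ^ 3 * u₄ ^ 3 + 64 * u₂ ^ 6 * u₃ ^ 9 + 6 * u₂ ^ 5 * u₄ ^ 5
      + 48 * u₂ ^ 4 * u₃ ^ 6 * u₄ ^ 2 + 12 * u₂ ^ 2 * u₃ ^ 3 * u₄ ^ 4 + u₄ ^ 6)
    / (216 * u₂ ^ 12 * u₃ ^ 6)

/-- Ward's construction: the point `(x, −u₂)` lies on the curve `y² = 4x³ − g₂x − g₃`,
i.e. `u₂² = 4x³ − g₂·x − g₃` holds for the quantities recovered from `u₂, u₃, u₄`. -/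
theorem ward_point_on_curve {F : Type*} [Field F]
    (hchar2 : ringChar F ≠ 2) (hchar3 : ringChar F ≠ 3)
    (u₂ u₃ u₄ : F) (h : u₂ * u₃ ≠ 0) :
    u₂ ^ 2 = 4 * wardX u₂ u₃ u₄ ^ 3 - wardG₂ u₂ u₃ u₄ * wardX u₂ u₃ u₄
      - wardG₃ u₂ u₃ u₄ := by
  obtain ⟨h2, h3⟩ := mul_ne_zero_iff.mp h
  have two_ne : (2 : F) ≠ 0 := Ring.two_ne_zero hchar2
  have three_ne : (3 : F) ≠ 0 := by
    intro h0
    have hdvd : ringChar F ∣ 3 := ringChar.dvd (by exact_mod_cast h0)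
    rcases (Nat.dvd_prime Nat.prime_three).mp hdvd with h1 | h1
    · exact CharP.ringChar_ne_one h1
    · exact hchar3 h1
  have h12 : (12 : F) ≠ 0 := by
    rw [show (12 : F) = 2 ^ 2 * 3 by norm_num]
    exact mul_ne_zero (pow_ne_zero 2 two_ne) three_ne
  have h216 : (216 : F) ≠ 0 := by
    rw [show (216 : F) = 2 ^ 3 * 3 ^ 3 by norm_num]
    exact mul_ne_zero (pow_ne_zero 3 two_ne) (pow_ne_zero 3 three_ne)
  unfold wardX wardG₂ wardG₃
  field_simp
  ring
end

section
/- Let u₂, u₃, u₄ be integers with u₂·u₃ ≠ 0 and u₂ ∣ u₄. Then there exists a function w : ℤ → ℤ which is an elliptic sequence and a divisibility sequence with w(0)=0, w(1)=1, w(2)=u₂, w(3)=u₃ and w(4)=u₄; that is, the tuple (u₂,u₃,u₄) defines a proper elliptic divisibility sequence. (Ward's criterion: a tuple u₂,u₃,u₄ defines a proper elliptic divisibility sequence if and only if the u_i are integral with u₂ ∣ u₄.) -/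
/-- An elliptic sequence over a commutative ring `R`. -/
def IsEllSeq {R : Type*} [CommRing R] (w : ℤ → R) : Prop :=
  ∀ m n : ℤ, w (m + n) * w (m - n) =
    w (m + 1) * w (m - 1) * w n ^ 2 - w (n + 1) * w (n - 1) * w m ^ 2

/-- A divisibility sequence: `w(n) ∣ w(m)` whenever `n ∣ m`. -/
def IsDivSeq {R : Type*} [CommRing R] (w : ℤ → R) : Prop :=
  ∀ m n : ℤ, n ∣ m → w n ∣ w m

lemma abs_emod_two (a : ℤ) : |a| % 2 = a % 2 := by
  obtain h | h := abs_choice a <;> rw [h]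
  omega

namespace IsEllipticNet

section AtomRel

variable {R : Type*} [CommRing R] {W : ℤ → R}

lemma atomRel_swap₁₂ (odd : W.Odd) (a b c d : ℤ) :
    atomRel W b a c d = -atomRel W a b c d := by
  simp_rw [atomRel, ← neg_atom odd a b]
  ring

/-- The Plücker relation: the elliptic relators `ERₐ(x, y, r, s)` generate, up to a factor of
`Wₐ(r, s)²`, all elliptic relators. -/
lemma sq_atom_mul_atomRel_eq_zero {S : Set ℤ} {r s : ℤ}
    (h : ∀ x ∈ S, ∀ y ∈ S, atomRel W x y r s = 0) {a b c d : ℤ}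
    (ha : a ∈ S) (hb : b ∈ S) (hc : c ∈ S) (hd : d ∈ S) :
    atom W r s ^ 2 * atomRel W a b c d = 0 := by
  have hab := h a ha b hb
  have hac := h a ha c hc
  have had := h a ha d hd
  have hbc := h b hb c hc
  have hbd := h b hb d hd
  have hcd := h c hc d hd
  simp only [atomRel] at hab hac had hbc hbd hcd ⊢
  linear_combination atom W r s * atom W c d * hab - atom W r s * atom W b d * hac +
    atom W r s * atom W b c * had +
    (atom W a r * atom W b s - atom W a s * atom W b r) * hcd -
    (atom W a r * atom W c s - atom W a s * atom W c r) * hbd +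
    (atom W a r * atom W d s - atom W a s * atom W d r) * hbc

lemma atomRel_two_zero (one : W 1 = 1) (m n : ℤ) : atomRel W (2 * m) (2 * n) 2 0 =
    W (m + n) * W (m - n) - W (m + 1) * W (m - 1) * W n ^ 2 + W (n + 1) * W (n - 1) * W m ^ 2 := by
  rw [show (2 : ℤ) = 2 * 1 by rfl, show (0 : ℤ) = 2 * 0 by rfl]
  simp only [atomRel, mul_assoc, atom_even, add_zero, sub_zero, one]
  ring_nf

lemma atomRel_three_one (one : W 1 = 1) (m n : ℤ) :
    atomRel W (2 * m + 1) (2 * n + 1) 3 1 =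
      W (m + n + 1) * W (m - n) * W 2 - W (m + 2) * W (m - 1) * W (n + 1) * W n +
        W (m + 1) * W m * W (n + 2) * W (n - 1) := by
  rw [show (3 : ℤ) = 2 * 1 + 1 by rfl]
  have h (k : ℤ) : atom W (2 * k + 1) 1 = W (k + 1) * W k := by simpa using atom_odd W k 0
  simp only [atomRel, atom_odd, h]
  norm_num [one, add_assoc]
  ring

end AtomRel

section Induction

variable {R : Type*} [CommRing R] [IsDomain R] {W : ℤ → R}

lemma atomRel_eq_zero_of_recurrence (odd : W.Odd) (zero : W 0 = 0) (one : W 1 = 1) (two : W 2 ≠ 0)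
    (rec_even : ∀ m, W (2 * m) * W 2 =
      W (m - 1) ^ 2 * W m * W (m + 2) - W (m - 2) * W m * W (m + 1) ^ 2)
    (rec_odd : ∀ m, W (2 * m + 1) = W (m + 2) * W m ^ 3 - W (m - 1) * W (m + 1) ^ 3)
    (N : ℕ) : ∀ a b c d : ℤ, (d % 2 = a % 2 ∧ d % 2 = b % 2 ∧ d % 2 = c % 2) →
      |a| ≤ N → |b| ≤ N → |c| ≤ N → |d| ≤ N → atomRel W a b c d = 0 := by
  induction N using Nat.strong_induction_on with | _ N ih =>
  have small : ∀ a b c d : ℤ, (d % 2 = a % 2 ∧ d % 2 = b % 2 ∧ d % 2 = c % 2) →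
      |a| < N → |b| < N → |c| < N → |d| < N → atomRel W a b c d = 0 := by
    intro a b c d par ha hb hc hd
    have := abs_nonneg a
    exact ih (N - 1) (by omega) a b c d par (by omega) (by omega) (by omega) (by omega)
  have even_top : ∀ b : ℤ, (N : ℤ) % 2 = 0 → b % 2 = 0 → |b| ≤ N → atomRel W N b 2 0 = 0 := by
    intro b hN hb hbN
    rw [← abs_emod_two] at hb
    rw [← atomRel_abs₂ odd]
    have hb0 := abs_nonneg b
    generalize |b| = b at *
    obtain h | h | h : b = N ∨ b = N - 2 ∨ b < N - 2 := by omega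
    · simp [h, zero]
    · obtain ⟨m, rfl⟩ : ∃ m, b = 2 * m := ⟨b / 2, by omega⟩
      rw [show (N : ℤ) = 2 * (m + 1) by omega, atomRel_two_zero one]
      have := rec_odd m
      ring_nf at this ⊢
      rw [one, this]
      ring
    · rw [← atomRel_avg_sub W (by omega)]
      exact small _ _ _ _ (by omega) (abs_lt.2 (by omega)) (abs_lt.2 (by omega))
        (abs_lt.2 (by omega)) (abs_lt.2 (by omega))
  have odd_top : ∀ b : ℤ, (N : ℤ) % 2 = 1 → b % 2 = 1 → |b| ≤ N → atomRel W N b 3 1 = 0 := by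
    intro b hN hb hbN
    rw [← abs_emod_two] at hb
    rw [← atomRel_abs₂ odd]
    have hb0 := abs_nonneg b
    generalize |b| = b at *
    obtain h | h | h : b = N ∨ b = N - 2 ∨ b < N - 2 := by omega
    · simp [h, zero]
    · obtain ⟨m, hm⟩ : ∃ m, b = 2 * (m - 1) + 1 := ⟨(b - 1) / 2 + 1, by omega⟩
      rw [hm, show (N : ℤ) = 2 * m + 1 by omega, atomRel_three_one one]
      have := rec_even m
      ring_nf at this ⊢
      rw [one]
      linear_combination this
    · rw [← atomRel_avg_sub W (by omega)]
      exact small _ _ _ _ (by omega) (abs_lt.2 (by omega)) (abs_lt.2 (by omega))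
        (abs_lt.2 (by omega)) (abs_lt.2 (by omega))
  have even_pair : ∀ a ∈ {x : ℤ | x % 2 = 0 ∧ |x| ≤ N}, ∀ b ∈ {x : ℤ | x % 2 = 0 ∧ |x| ≤ N},
      atomRel W a b 2 0 = 0 := by
    rintro a ⟨ha, haN⟩ b ⟨hb, hbN⟩
    obtain h | h := haN.eq_or_lt
    · rw [← atomRel_abs₁ odd, h]
      exact even_top b (by rw [← h, abs_emod_two, ha]) hb hbN
    obtain h' | h' := hbN.eq_or_lt
    · rw [← atomRel_abs₂ odd, h', atomRel_swap₁₂ odd,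
        even_top a (by rw [← h', abs_emod_two, hb]) ha haN, neg_zero]
    have ha' := abs_emod_two a
    have ha0 := abs_nonneg a
    by_cases hN : 2 < N
    · exact small _ _ _ _ (by omega) h h' (abs_lt.2 (by omega)) (abs_lt.2 (by omega))
    · rw [← atomRel_abs₁ odd, show |a| = 0 by omega]
      simp [atomRel_same₁₄ odd, zero]
  have odd_pair : ∀ a ∈ {x : ℤ | x % 2 = 1 ∧ |x| ≤ N}, ∀ b ∈ {x : ℤ | x % 2 = 1 ∧ |x| ≤ N},
      atomRel W a b 3 1 = 0 := by
    rintro a ⟨ha, haN⟩ b ⟨hb, hbN⟩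
    obtain h | h := haN.eq_or_lt
    · rw [← atomRel_abs₁ odd, h]
      exact odd_top b (by rw [← h, abs_emod_two, ha]) hb hbN
    obtain h' | h' := hbN.eq_or_lt
    · rw [← atomRel_abs₂ odd, h', atomRel_swap₁₂ odd,
        odd_top a (by rw [← h', abs_emod_two, hb]) ha haN, neg_zero]
    have ha' := abs_emod_two a
    have ha0 := abs_nonneg a
    by_cases hN : 3 < N
    · exact small _ _ _ _ (by omega) h h' (abs_lt.2 (by omega)) (abs_lt.2 (by omega))
    · rw [← atomRel_abs₁ odd, show |a| = 1 by omega]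
      simp [atomRel_same₁₄ odd, zero]
  rintro a b c d ⟨hda, hdb, hdc⟩ ha hb hc hd
  obtain h | h := Int.emod_two_eq d <;> rw [h] at hda hdb hdc
  · have := sq_atom_mul_atomRel_eq_zero even_pair ⟨hda.symm, ha⟩ ⟨hdb.symm, hb⟩ ⟨hdc.symm, hc⟩
      ⟨h, hd⟩
    have h20 : atom W 2 0 = 1 := by simpa [one] using atom_even W 1 0
    simpa [h20] using this
  · have := sq_atom_mul_atomRel_eq_zero odd_pair ⟨hda.symm, ha⟩ ⟨hdb.symm, hb⟩ ⟨hdc.symm, hc⟩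
      ⟨h, hd⟩
    have h31 : atom W 3 1 = W 2 := by simpa [one] using atom_odd W 1 0
    simpa [h31, two] using this

end Induction

end IsEllipticNet

section NormEDS

variable {R : Type*} [CommRing R]

lemma normEDS_two_three_two (n : ℤ) : normEDS (2 : ℤ) 3 2 n = n := by
  induction n using Int.negInduction with
  | nat n =>
    induction n using normEDSRec with
    | zero => simp
    | one => simp
    | two => simp
    | three => simp
    | four => simp
    | even m h₁ h₂ h₃ h₄ h₅ =>
      have h := normEDS_even (2 : ℤ) 3 2 (m + 3)
      push_cast at *
      ring_nf at *
      rw [h₁, h₂, h₃, h₄, h₅] at h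
      linarith
    | odd m h₁ h₂ h₃ h₄ =>
      have h := normEDS_odd (2 : ℤ) 3 2 (m + 2)
      push_cast at *
      ring_nf at *
      rw [h₁, h₂, h₃, h₄] at h
      linarith
  | neg ih n => rw [normEDS_neg, ih]

/-- The generic normalised EDS vanishes only at `0`. -/
lemma normEDS_X_ne_zero {n : ℤ} (hn : n ≠ 0) :
    normEDS (.X 0 : MvPolynomial (Fin 3) ℤ) (.X 1) (.X 2) n ≠ 0 := by
  intro h
  apply hn
  simpa [normEDS_two_three_two] using congr_arg (MvPolynomial.eval ![2, 3, 2]) h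

lemma isEllSeq_normEDS_of_ne_zero [IsDomain R] {b : R} (hb : b ≠ 0) (c d : R) :
    IsEllSeq (normEDS b c d) := by
  intro m n
  have h := IsEllipticNet.atomRel_eq_zero_of_recurrence (W := normEDS b c d)
    (normEDS_neg b c d) (by simp) (by simp) (by simpa)
    (fun m => by simpa using normEDS_even b c d m) (normEDS_odd b c d)
    ((2 * m).natAbs + (2 * n).natAbs + 2) (2 * m) (2 * n) 2 0 (by omega)
    (abs_le.2 (by omega)) (abs_le.2 (by omega)) (abs_le.2 (by omega)) (abs_le.2 (by omega))
  rw [IsEllipticNet.atomRel_two_zero (by simp)] at h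
  linear_combination h

lemma normEDS_mul_complEDS_of_ne_zero [IsDomain R] {b c d : R} (hb : b ≠ 0) {k : ℤ}
    (hk : normEDS b c d k ≠ 0) (n : ℤ) :
    normEDS b c d k * complEDS b c d k n = normEDS b c d (n * k) := by
  induction n using Int.negInduction with
  | nat n =>
    induction n using complEDSRec with
    | zero => simp
    | one => simp
    | even m ih =>
      push_cast at ih ⊢
      rw [complEDS_even, ← mul_assoc, ih, normEDS_mul_complEDS₂, mul_assoc]
    | odd m ih₁ ih₂ =>
      push_cast at ih₁ ih₂ ⊢
      have h := isEllSeq_normEDS_of_ne_zero hb c d ((m + 1 + 1) * k) ((m + 1) * k)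
      rw [show ((m : ℤ) + 1 + 1) * k + (m + 1) * k = (2 * (m + 1) + 1) * k by ring,
        show ((m : ℤ) + 1 + 1) * k - (m + 1) * k = k by ring] at h
      apply mul_right_cancel₀ hk
      rw [h, complEDS_odd, ← ih₁, add_assoc (m : ℤ) 1 1, one_add_one_eq_two, ← ih₂]
      ring
  | neg ih n => simp only [complEDS_neg, neg_mul, normEDS_neg, mul_neg, ih]

lemma normEDS_mul_complEDS (b c d : R) (k n : ℤ) :
    normEDS b c d k * complEDS b c d k n = normEDS b c d (n * k) := by
  obtain rfl | hk := eq_or_ne k 0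
  · simp
  have h := congr_arg (MvPolynomial.aeval ![b, c, d]) <|
    normEDS_mul_complEDS_of_ne_zero (MvPolynomial.X_ne_zero 0) (normEDS_X_ne_zero hk) n
  simpa using h

lemma isDivSeq_normEDS (b c d : R) : IsDivSeq (normEDS b c d) := by
  rintro _ k ⟨n, rfl⟩
  exact ⟨complEDS b c d k n, by rw [normEDS_mul_complEDS, mul_comm]⟩

end NormEDS

/-- Ward's criterion: integers `u₂, u₃, u₄` with `u₂·u₃ ≠ 0` and `u₂ ∣ u₄` define a proper
elliptic divisibility sequence. -/
theorem ward_criterion (u₂ u₃ u₄ : ℤ) (h : u₂ * u₃ ≠ 0) (hdvd : u₂ ∣ u₄) :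
    ∃ w : ℤ → ℤ, IsEllSeq w ∧ IsDivSeq w ∧
      w 0 = 0 ∧ w 1 = 1 ∧ w 2 = u₂ ∧ w 3 = u₃ ∧ w 4 = u₄ := by
  obtain ⟨d, rfl⟩ := hdvd
  exact ⟨normEDS u₂ u₃ d, isEllSeq_normEDS_of_ne_zero (left_ne_zero_of_mul h) u₃ d,
    isDivSeq_normEDS u₂ u₃ d, by simp, by simp, by simp, by simp, by simp [mul_comm]⟩
end

section
/- Let F be a field and let w, w' : ℤ → F be elliptic sequences with w(0) = w'(0) = 0, w(1) = w'(1) = 1, w(2) = w'(2) ≠ 0, w(3) = w'(3) and w(4) = w'(4). Then w(n) = w'(n) for all integers n ≥ 0; that is, a proper elliptic divisibility sequence is determined on nonnegative indices by its defining terms u₂, u₃, u₄. -/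
namespace IsEllSeq

variable {R : Type*} [CommRing R] {w : ℤ → R}

lemma two_mul_mul_two (hw : IsEllSeq w) (m : ℤ) :
    w (2 * m) * w 2 =
      w (m + 2) * w m * w (m - 1) ^ 2 - w m * w (m - 2) * w (m + 1) ^ 2 := by
  convert hw (m + 1) (m - 1) using 3 <;> ring_nf

lemma two_mul_add_one_mul_one (hw : IsEllSeq w) (m : ℤ) :
    w (2 * m + 1) * w 1 =
      w (m + 2) * w m * w m ^ 2 - w (m + 1) * w (m - 1) * w (m + 1) ^ 2 := by
  convert hw (m + 1) m using 3 <;> ring_nf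

end IsEllSeq

/-- A proper elliptic divisibility sequence over a field is determined on nonnegative
indices by its defining terms `u₂, u₃, u₄`. -/
theorem ellSeq_unique {F : Type*} [Field F] (w w' : ℤ → F)
    (hw : IsEllSeq w) (hw' : IsEllSeq w')
    (h0 : w 0 = 0) (h0' : w' 0 = 0) (h1 : w 1 = 1) (h1' : w' 1 = 1)
    (h2 : w 2 = w' 2) (h2ne : w 2 ≠ 0) (h3 : w 3 = w' 3) (h4 : w 4 = w' 4) :
    ∀ n : ℤ, 0 ≤ n → w n = w' n := by
  intro n hn
  lift n to ℕ using hn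
  induction n using Nat.strong_induction_on with
  | _ n ih =>
    have eq_of_lt (k : ℤ) (hk : 0 ≤ k) (hkn : k < n) : w k = w' k := by
      lift k to ℕ using hk
      exact ih k (by exact_mod_cast hkn)
    by_cases hn : n < 5
    · interval_cases n <;> simp [*]
    obtain ⟨m, rfl | rfl⟩ := n.even_or_odd'
    · push_cast at eq_of_lt ⊢
      have e := hw.two_mul_mul_two m
      rw [eq_of_lt (m + 2) (by lia) (by lia), eq_of_lt m (by lia) (by lia),
        eq_of_lt (m - 1) (by lia) (by lia), eq_of_lt (m - 2) (by lia) (by lia),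
        eq_of_lt (m + 1) (by lia) (by lia), ← hw'.two_mul_mul_two m, ← h2] at e
      exact mul_right_cancel₀ h2ne e
    · push_cast at eq_of_lt ⊢
      have e := hw.two_mul_add_one_mul_one m
      rw [eq_of_lt (m + 2) (by lia) (by lia), eq_of_lt m (by lia) (by lia),
        eq_of_lt (m - 1) (by lia) (by lia), eq_of_lt (m + 1) (by lia) (by lia),
        ← hw'.two_mul_add_one_mul_one m, h1, h1', mul_one, mul_one] at e
      exact e
end

section
/- Let K be a field, let W be the affine Weierstrass curve y² + a₁xy + a₃y = x³ + a₂x² + a₄x + a₆ over K, and let P = (x₀, y₀) be a K-rational point satisfying the Weierstrass equation. Then the sequence n ↦ ψ_n(P), obtained by evaluating the division polynomials of W at P, is an elliptic sequence with ψ₀(P) = 0 and ψ₁(P) = 1; that is, it satisfies ψ_{m+n}(P)·ψ_{m−n}(P) = ψ_{m+1}(P)·ψ_{m−1}(P)·ψ_n(P)² − ψ_{n+1}(P)·ψ_{n−1}(P)·ψ_m(P)² for all m, n ∈ ℤ. -/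
open Polynomial

namespace IsEllSeq

section Relations

variable {R : Type*} [CommRing R] (w : ℤ → R)

/-- The elliptic relation at the pair `(m, n)`. -/
def EvenRel (m n : ℤ) : Prop :=
  w (m + n) * w (m - n) =
    w (m + 1) * w (m - 1) * w n ^ 2 - w (n + 1) * w (n - 1) * w m ^ 2

/-- The analogue of the elliptic relation at the pair of half-integers `(m + 1/2, n + 1/2)`. -/
def OddRel (m n : ℤ) : Prop :=
  w (m + n + 1) * w (m - n) * w 2 =
    w (m + 2) * w (m - 1) * (w (n + 1) * w n) - w (n + 2) * w (n - 1) * (w (m + 1) * w m)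

variable {w}

lemma EvenRel.symm (odd : w.Odd) {m n : ℤ} (h : EvenRel w m n) : EvenRel w n m := by
  have h₁ := odd (m - n)
  rw [neg_sub] at h₁
  rw [EvenRel, add_comm n m, h₁]
  rw [EvenRel] at h
  linear_combination -h

lemma EvenRel.neg_right (odd : w.Odd) {m n : ℤ} (h : EvenRel w m n) : EvenRel w m (-n) := by
  rw [EvenRel] at h ⊢
  rw [show -n + 1 = -(n - 1) by ring, show -n - 1 = -(n + 1) by ring, odd, odd, odd,
    sub_neg_eq_add, ← sub_eq_add_neg]
  linear_combination h

lemma EvenRel.of_natAbs (odd : w.Odd) {m n : ℤ} (h : EvenRel w |m| |n|) : EvenRel w m n := by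
  have h₁ : EvenRel w |m| n := by
    rcases abs_choice n with hn | hn <;> rw [hn] at h
    exacts [h, by simpa using h.neg_right odd]
  rcases abs_choice m with hm | hm <;> rw [hm] at h₁
  exacts [h₁, by simpa using ((h₁.symm odd).neg_right odd).symm odd]

lemma OddRel.symm (odd : w.Odd) {m n : ℤ} (h : OddRel w m n) : OddRel w n m := by
  have h₁ := odd (m - n)
  rw [neg_sub] at h₁
  rw [OddRel, add_comm n m, h₁]
  rw [OddRel] at h
  linear_combination -h

lemma OddRel.reflect_right (odd : w.Odd) {m n : ℤ} (h : OddRel w m n) :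
    OddRel w m (-1 - n) := by
  rw [OddRel] at h ⊢
  rw [show -1 - n + 1 = -n by ring, show -1 - n + 2 = -(n - 1) by ring,
    show -1 - n - 1 = -(n + 2) by ring, show m + (-1 - n) + 1 = m - n by ring,
    show m - (-1 - n) = m + n + 1 by ring, show -1 - n = -(n + 1) by ring, odd, odd, odd, odd]
  linear_combination h

/-- Pairwise elliptic relations imply the Plücker relation on integers. -/
lemma evenRel_plucker {p q r s : ℤ} (hpq : EvenRel w p q) (hrs : EvenRel w r s)
    (hpr : EvenRel w p r) (hqs : EvenRel w q s) (hps : EvenRel w p s) (hqr : EvenRel w q r) :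
    w (p + q) * w (p - q) * (w (r + s) * w (r - s))
      - w (p + r) * w (p - r) * (w (q + s) * w (q - s))
      + w (p + s) * w (p - s) * (w (q + r) * w (q - r)) = 0 := by
  rw [hpq, hrs, hpr, hqs, hps, hqr]
  ring

/-- Pairwise elliptic relations imply the Plücker relation on half-integers. -/
lemma oddRel_plucker [IsDomain R] (two : w 2 ≠ 0) {p q r s : ℤ} (hpq : OddRel w p q)
    (hrs : OddRel w r s) (hpr : OddRel w p r) (hqs : OddRel w q s) (hps : OddRel w p s)
    (hqr : OddRel w q r) :
    w (p + q + 1) * w (p - q) * (w (r + s + 1) * w (r - s))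
      - w (p + r + 1) * w (p - r) * (w (q + s + 1) * w (q - s))
      + w (p + s + 1) * w (p - s) * (w (q + r + 1) * w (q - r)) = 0 := by
  have key (A B C D E F : R) (h : A * w 2 * (B * w 2) - C * w 2 * (D * w 2)
      + E * w 2 * (F * w 2) = 0) : A * B - C * D + E * F = 0 := by
    refine (mul_eq_zero.mp (?_ : w 2 ^ 2 * _ = 0)).resolve_left (pow_ne_zero 2 two)
    linear_combination h
  apply key
  rw [hpq, hrs, hpr, hqs, hps, hqr]
  ring

lemma evenRel_of_le (odd : w.Odd) {N : ℤ}
    (h : ∀ m n : ℤ, 0 ≤ n → n ≤ m → 2 * m ≤ N → EvenRel w m n)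
    {m n : ℤ} (hm : -N ≤ 2 * m ∧ 2 * m ≤ N) (hn : -N ≤ 2 * n ∧ 2 * n ≤ N) :
    EvenRel w m n := by
  have abs_bound {k : ℤ} (hk : -N ≤ 2 * k ∧ 2 * k ≤ N) : 2 * |k| ≤ N := by
    rcases abs_choice k with h | h <;> omega
  refine .of_natAbs odd ?_
  rcases le_total |n| |m| with hmn | hmn
  · exact h _ _ (abs_nonneg n) hmn (abs_bound hm)
  · exact (h _ _ (abs_nonneg m) hmn (abs_bound hn)).symm odd

lemma oddRel_of_le (odd : w.Odd) {N : ℤ}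
    (h : ∀ m n : ℤ, 0 ≤ n → n ≤ m → 2 * m + 1 ≤ N → OddRel w m n)
    {m n : ℤ} (hm : -N ≤ 2 * m + 1 ∧ 2 * m + 1 ≤ N) (hn : -N ≤ 2 * n + 1 ∧ 2 * n + 1 ≤ N) :
    OddRel w m n := by
  have nonneg {m n : ℤ} (hm₀ : 0 ≤ m) (hn₀ : 0 ≤ n) (hm : 2 * m + 1 ≤ N) (hn : 2 * n + 1 ≤ N) :
      OddRel w m n := by
    rcases le_total n m with hmn | hmn
    · exact h _ _ hn₀ hmn hm
    · exact (h _ _ hm₀ hmn hn).symm odd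
  have nonneg_left {m n : ℤ} (hm₀ : 0 ≤ m) (hm : 2 * m + 1 ≤ N)
      (hn : -N ≤ 2 * n + 1 ∧ 2 * n + 1 ≤ N) : OddRel w m n := by
    rcases le_or_gt 0 n with hn₀ | hn₀
    · exact nonneg hm₀ hn₀ hm hn.2
    · have := (nonneg (n := -1 - n) hm₀ (by omega) hm (by omega)).reflect_right odd
      rwa [sub_sub_cancel] at this
  rcases le_or_gt 0 m with hm₀ | hm₀
  · exact nonneg_left hm₀ hm.2 hn
  · have := ((nonneg_left (m := -1 - m) (n := n) (by omega) (by omega) hn).symm odd).reflect_right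
      odd
    rw [sub_sub_cancel] at this
    exact this.symm odd

/-- An odd sequence with `w 1 = 1` satisfying the even and odd recurrences satisfies all elliptic
relations. The induction is on the larger of the two (doubled) indices. -/
lemma evenRel_and_oddRel [IsDomain R] (odd : w.Odd) (one : w 1 = 1) (two : w 2 ≠ 0)
    (even_rec : ∀ m : ℤ, w (2 * m) * w 2 =
      w (m - 1) ^ 2 * w m * w (m + 2) - w (m - 2) * w m * w (m + 1) ^ 2)
    (odd_rec : ∀ m : ℤ, w (2 * m + 1) = w (m + 2) * w m ^ 3 - w (m - 1) * w (m + 1) ^ 3)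
    (zero : w 0 = 0) (N : ℕ) (m n : ℤ) (hn : 0 ≤ n) (hmn : n ≤ m) :
    (2 * m ≤ N → EvenRel w m n) ∧ (2 * m + 1 ≤ N → OddRel w m n) := by
  induction N generalizing m n with
  | zero =>
    refine ⟨fun h ↦ ?_, fun h ↦ by push_cast at h; omega⟩
    obtain rfl : m = n := by push_cast at h; omega
    simp [EvenRel, zero]
  | succ N ih =>
    have even {m n : ℤ} (hm : -N ≤ 2 * m ∧ 2 * m ≤ N) (hn : -N ≤ 2 * n ∧ 2 * n ≤ N) :
        EvenRel w m n :=
      evenRel_of_le odd (fun m n hn hmn ↦ (ih m n hn hmn).1) hm hn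
    have odd {m n : ℤ} (hm : -N ≤ 2 * m + 1 ∧ 2 * m + 1 ≤ N)
        (hn : -N ≤ 2 * n + 1 ∧ 2 * n + 1 ≤ N) : OddRel w m n :=
      oddRel_of_le odd (fun m n hn hmn ↦ (ih m n hn hmn).2) hm hn
    push_cast
    obtain rfl | rfl | hmn : m = n ∨ m = n + 1 ∨ n + 2 ≤ m := by omega
    · simp [EvenRel, OddRel, zero]
    · refine ⟨fun _ ↦ ?_, fun _ ↦ ?_⟩
      · have h := odd_rec n
        rw [EvenRel, show n + 1 + n = 2 * n + 1 by ring, h]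
        ring_nf
        simp only [one]
        ring
      · have h := even_rec (n + 1)
        rw [OddRel, show n + 1 + n + 1 = 2 * (n + 1) by ring, add_sub_cancel_left, one, mul_one, h]
        ring_nf
    · refine ⟨fun hN ↦ ?_, fun hN ↦ ?_⟩ <;> obtain ⟨t, ht | ht⟩ := (m + n).even_or_odd'
      · have h := oddRel_plucker two (p := t) (q := t - 1) (r := t - n) (s := t - m)
          (odd (by omega) (by omega)) (odd (by omega) (by omega)) (odd (by omega) (by omega))
          (odd (by omega) (by omega)) (odd (by omega) (by omega)) (odd (by omega) (by omega))
        obtain rfl : m = 2 * t - n := by omega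
        rw [EvenRel]
        ring_nf at h ⊢
        simp only [one] at h
        linear_combination h
      · have h := evenRel_plucker (w := w) (p := t + 1) (q := t) (r := t + 1 - n) (s := t + 1 - m)
          (even (by omega) (by omega)) (even (by omega) (by omega)) (even (by omega) (by omega))
          (even (by omega) (by omega)) (even (by omega) (by omega)) (even (by omega) (by omega))
        obtain rfl : m = 2 * t + 1 - n := by omega
        rw [EvenRel]
        ring_nf at h ⊢
        simp only [one] at h
        linear_combination h
      · have h := evenRel_plucker (w := w) (p := t + 1) (q := t) (r := t + 1 - n) (s := t + 1 - m)
          (even (by omega) (by omega)) (even (by omega) (by omega)) (even (by omega) (by omega))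
          (even (by omega) (by omega)) (even (by omega) (by omega)) (even (by omega) (by omega))
        obtain rfl : m = 2 * t - n := by omega
        rw [OddRel]
        ring_nf at h ⊢
        simp only [one] at h
        linear_combination h
      · have h := oddRel_plucker two (p := t + 1) (q := t) (r := t + 1 - n) (s := t + 1 - m)
          (odd (by omega) (by omega)) (odd (by omega) (by omega)) (odd (by omega) (by omega))
          (odd (by omega) (by omega)) (odd (by omega) (by omega)) (odd (by omega) (by omega))
        obtain rfl : m = 2 * t + 1 - n := by omega
        rw [OddRel]
        ring_nf at h ⊢
        simp only [one] at h
        linear_combination h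

end Relations

lemma normEDS_of_isDomain {R : Type*} [CommRing R] [IsDomain R] {b : R} (hb : b ≠ 0) (c d : R) :
    IsEllSeq (normEDS b c d) := by
  intro m n
  have odd : (normEDS b c d).Odd := normEDS_neg b c d
  refine evenRel_of_le (N := 2 * |m| + 2 * |n|) odd (fun m' n' hn hmn h ↦ ?_)
    (by grind) (by grind)
  exact (evenRel_and_oddRel odd (by simp) (by simpa using hb)
    (by simpa using normEDS_even b c d) (normEDS_odd b c d) (by simp)
    (2 * m').toNat m' n' hn hmn).1 (Int.self_le_toNat _)

/-- A normalised elliptic divisibility sequence is an elliptic sequence. -/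
theorem normEDS {R : Type*} [CommRing R] (b c d : R) : IsEllSeq (normEDS b c d) := by
  intro m n
  have h := congrArg (MvPolynomial.aeval (R := ℤ) ![b, c, d]) <|
    normEDS_of_isDomain (MvPolynomial.X_ne_zero (R := ℤ) (0 : Fin 3)) (.X 1) (.X 2) m n
  simpa using h

end IsEllSeq

lemma WeierstrassCurve.evalEval_Ψ {R : Type*} [CommRing R] (W : WeierstrassCurve R) {x y : R}
    (h : W.toAffine.Equation x y) (n : ℤ) :
    (W.Ψ n).evalEval x y =
      normEDS (W.ψ₂.evalEval x y) (W.Ψ₃.eval x) (W.preΨ₄.eval x) n := by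
  have hsq : W.Ψ₂Sq.eval x = W.ψ₂.evalEval x y ^ 2 := by
    have := congrArg (evalEval x y) W.C_Ψ₂Sq
    rw [WeierstrassCurve.Affine.Equation] at h
    simpa [evalEval_C, evalEval_sub, evalEval_mul, evalEval_pow, h] using this
  have hpre : (W.preΨ n).eval x =
      preNormEDS (W.ψ₂.evalEval x y ^ 4) (W.Ψ₃.eval x) (W.preΨ₄.eval x) n := by
    rw [WeierstrassCurve.preΨ, ← coe_evalRingHom, map_preNormEDS, map_pow, coe_evalRingHom, hsq,
      ← pow_mul]
  rw [WeierstrassCurve.Ψ, evalEval_mul, evalEval_C, hpre, normEDS]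
  split_ifs <;> simp

/-- For a `K`-rational point `P = (x₀, y₀)` satisfying the Weierstrass equation, the
sequence `n ↦ ψₙ(P)` of values of the division polynomials at `P` is an elliptic sequence
with `ψ₀(P) = 0` and `ψ₁(P) = 1`. -/
theorem divisionPolynomial_eval_isEllSeq {K : Type*} [Field K]
    (W : WeierstrassCurve K) (x₀ y₀ : K) (hP : W.toAffine.Equation x₀ y₀) :
    IsEllSeq (fun n : ℤ => (W.Ψ n).evalEval x₀ y₀) ∧
    (W.Ψ 0).evalEval x₀ y₀ = 0 ∧ (W.Ψ 1).evalEval x₀ y₀ = 1 := by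
  refine ⟨?_, by simp, by simp⟩
  simp only [W.evalEval_Ψ hP]
  exact IsEllSeq.normEDS _ _ _
end

section
/- Let F be a field of characteristic different from 2 and let u₂, u₃, u₄ ∈ F with u₂·u₃ ≠ 0. Define a₁ = 0, a₃ = u₂, a₄ = (u₄ + u₂⁵)/(2u₂u₃), a₂ = (u₃ + a₄²)/u₂², a₆ = 0, and let W be the Weierstrass curve y² + a₁xy + a₃y = x³ + a₂x² + a₄x + a₆ over F. Then the point (0,0) lies on W, and the division polynomials of W evaluated at (0,0) satisfy ψ₂((0,0)) = u₂, ψ₃((0,0)) = u₃ and ψ₄((0,0)) = u₄. (Shipsey's first recovery formula: the curve W carries the point (0,0) whose associated elliptic divisibility sequence has defining terms u₂, u₃, u₄.) -/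
open Polynomial

/-- Shipsey's first recovery formula: for `u₂, u₃, u₄` in a field of characteristic `≠ 2`
with `u₂·u₃ ≠ 0`, the Weierstrass curve with `a₁ = 0`, `a₃ = u₂`,
`a₄ = (u₄ + u₂⁵)/(2u₂u₃)`, `a₂ = (u₃ + a₄²)/u₂²`, `a₆ = 0` carries the point `(0,0)`,
whose associated division polynomial values satisfy `ψ₂ = u₂`, `ψ₃ = u₃`, `ψ₄ = u₄`. -/
theorem shipsey_first {F : Type*} [Field F] (hchar : ringChar F ≠ 2)
    (u₂ u₃ u₄ : F) (h : u₂ * u₃ ≠ 0) :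
    let a₄ : F := (u₄ + u₂ ^ 5) / (2 * u₂ * u₃)
    let W : WeierstrassCurve F := ⟨0, (u₃ + a₄ ^ 2) / u₂ ^ 2, u₂, a₄, 0⟩
    W.toAffine.Equation 0 0 ∧
    (W.Ψ 2).evalEval 0 0 = u₂ ∧ (W.Ψ 3).evalEval 0 0 = u₃ ∧
    (W.Ψ 4).evalEval 0 0 = u₄ := by
  have h2 : (2 : F) ≠ 0 := Ring.two_ne_zero hchar
  have hu₂ : u₂ ≠ 0 := left_ne_zero_of_mul h
  have hu₃ : u₃ ≠ 0 := right_ne_zero_of_mul h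
  intro a₄ W
  have hb₈ : W.b₈ = u₃ := by
    simp only [W, WeierstrassCurve.b₈]
    field_simp
    ring
  have hψ₂ : W.ψ₂.evalEval 0 0 = u₂ := by
    simp [WeierstrassCurve.ψ₂, WeierstrassCurve.Affine.evalEval_polynomialY, W]
  refine ⟨by simp [W, WeierstrassCurve.Affine.equation_zero], ?_, ?_, ?_⟩
  · rw [W.Ψ_two, hψ₂]
  · simp [evalEval, WeierstrassCurve.Ψ₃, hb₈]
  · have hpre : W.preΨ₄.eval 0 = 2 * a₄ * u₃ - u₂ ^ 4 := by
      simp [WeierstrassCurve.preΨ₄, hb₈]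
      simp only [W, WeierstrassCurve.b₄, WeierstrassCurve.b₆]
      ring
    rw [W.Ψ_four, evalEval_mul, hψ₂, evalEval_C, hpre]
    simp only [a₄]
    field_simp
    ring
end

section
/- Let F be a field of characteristic different from 2 and let u₂, u₃, u₄ ∈ F with u₂·u₃ ≠ 0. Define a₁ = 1, a₃ = u₂, a₄ = (u₄ − u₂²u₃ + u₂⁵)/(2u₂u₃), a₂ = (u₃ + a₁a₃a₄ + a₄²)/u₂², a₆ = 0, and let W be the Weierstrass curve y² + a₁xy + a₃y = x³ + a₂x² + a₄x + a₆ over F. Then the point (0,0) lies on W, and the division polynomials of W evaluated at (0,0) satisfy ψ₂((0,0)) = u₂, ψ₃((0,0)) = u₃ and ψ₄((0,0)) = u₄. (Shipsey's second recovery formula: the curve W carries the point (0,0) whose associated elliptic divisibility sequence has defining terms u₂, u₃, u₄.) -/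
open Polynomial

namespace WeierstrassCurve

variable {R : Type*} [CommRing R] (W : WeierstrassCurve R)

lemma evalEval_Ψ_two_zero : (W.Ψ 2).evalEval 0 0 = W.a₃ := by
  simp [Ψ_two, ψ₂, Affine.evalEval_polynomialY_zero]

lemma evalEval_Ψ_three_zero : (W.Ψ 3).evalEval 0 0 = W.b₈ := by
  simp [Ψ_three, Ψ₃, evalEval]

lemma evalEval_Ψ_four_zero :
    (W.Ψ 4).evalEval 0 0 = (W.b₄ * W.b₈ - W.b₆ ^ 2) * W.a₃ := by
  simp [Ψ_four, preΨ₄, ψ₂, Affine.evalEval_polynomialY_zero, evalEval_mul, evalEval_C]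

end WeierstrassCurve

/-- Shipsey's second recovery formula: for `u₂, u₃, u₄` in a field of characteristic `≠ 2`
with `u₂·u₃ ≠ 0`, the Weierstrass curve with `a₁ = 1`, `a₃ = u₂`,
`a₄ = (u₄ − u₂²u₃ + u₂⁵)/(2u₂u₃)`, `a₂ = (u₃ + a₁a₃a₄ + a₄²)/u₂²`, `a₆ = 0` carries the
point `(0,0)`, whose associated division polynomial values satisfy `ψ₂ = u₂`, `ψ₃ = u₃`,
`ψ₄ = u₄`. -/
theorem shipsey_second {F : Type*} [Field F] (hchar : ringChar F ≠ 2)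
    (u₂ u₃ u₄ : F) (h : u₂ * u₃ ≠ 0) :
    let a₄ : F := (u₄ - u₂ ^ 2 * u₃ + u₂ ^ 5) / (2 * u₂ * u₃)
    let W : WeierstrassCurve F := ⟨1, (u₃ + 1 * u₂ * a₄ + a₄ ^ 2) / u₂ ^ 2, u₂, a₄, 0⟩
    W.toAffine.Equation 0 0 ∧
    (W.Ψ 2).evalEval 0 0 = u₂ ∧ (W.Ψ 3).evalEval 0 0 = u₃ ∧
    (W.Ψ 4).evalEval 0 0 = u₄ := by
  have h2 : (2 : F) ≠ 0 := Ring.two_ne_zero hchar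
  obtain ⟨hu₂, hu₃⟩ := mul_ne_zero_iff.mp h
  intro a₄ W
  have ha₄ : 2 * u₂ * u₃ * a₄ = u₄ - u₂ ^ 2 * u₃ + u₂ ^ 5 :=
    mul_div_cancel₀ _ (mul_ne_zero (mul_ne_zero h2 hu₂) hu₃)
  have ha₂ : W.a₂ * u₂ ^ 2 = u₃ + 1 * u₂ * a₄ + a₄ ^ 2 :=
    div_mul_cancel₀ _ (pow_ne_zero 2 hu₂)
  have hb₄ : W.b₄ = 2 * a₄ + u₂ := by simp [W, WeierstrassCurve.b₄]
  have hb₆ : W.b₆ = u₂ ^ 2 := by simp [W, WeierstrassCurve.b₆]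
  have hb₈ : W.b₈ = u₃ := by
    have : W.b₈ = W.a₂ * u₂ ^ 2 - u₂ * a₄ - a₄ ^ 2 := by
      simp only [WeierstrassCurve.b₈, W]; ring
    linear_combination this + ha₂
  refine ⟨W.toAffine.equation_zero.mpr rfl, W.evalEval_Ψ_two_zero,
    W.evalEval_Ψ_three_zero.trans hb₈, ?_⟩
  rw [W.evalEval_Ψ_four_zero, hb₄, hb₆, hb₈]
  change ((2 * a₄ + u₂) * u₃ - (u₂ ^ 2) ^ 2) * u₂ = u₄
  linear_combination ha₄
end
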